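/- arXiv:2407.10594 — 3 statements merged into one kernel-verified Lean document; each statement's English description precedes it below -/
import Mathlib

section
/- Let (μ_n)_{n∈ℕ} be a sequence of Young measures on 𝕋^d × ℝ^k, and for each n let (μ_n^x)_{x∈𝕋^d} be a disintegration of μ_n with respect to Lebesgue measure on 𝕋^d (a family of Borel probability measures on ℝ^k, measurable in x, with ∫ f dμ_n = ∫_{𝕋^d} (∫_{ℝ^k} f(x,b) μ_n^x(db)) dx for all bounded continuous f). Assume that for every δ > 0 there exists a family (A_x)_{x∈𝕋^d} of compact subsets of ℝ^k such that sup_{n∈ℕ} ∫*_{𝕋^d} μ_n^x(ℝ^k ∖ A_x) dx < δ, where ∫* denotes the outer integral. Then there exist a subsequence (μ_{n_j}) and a Young measure μ on 𝕋^d × ℝ^k such that μ_{n_j} converges to μ in the sense of Young measures. -/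
open MeasureTheory Filter Topology
open scoped ENNReal

noncomputable section

instance : Fact (0 < 2 * Real.pi) := ⟨Real.two_pi_pos⟩

/-- The torus `𝕋^d = ℝ^d/(2πℤ)^d`, with its Haar (Lebesgue) measure of total mass
`(2π)^d`. -/
abbrev TorusD (d : ℕ) := Fin d → AddCircle (2 * Real.pi)

/-- `ℝ^k` with the Euclidean norm. -/
abbrev Ek (k : ℕ) := EuclideanSpace ℝ (Fin k)

/-- `𝕋^d × ℝ^k`. -/
abbrev Sp (d k : ℕ) := TorusD d × Ek k

/-- A Young measure on `𝕋^d × ℝ^k`: a nonnegative Borel measure `μ` with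
`μ(A × ℝ^k) = Leb(A)` for every Borel `A ⊆ 𝕋^d`. -/
def IsYoungMeasure (d k : ℕ) (μ : Measure (Sp d k)) : Prop :=
  ∀ A : Set (TorusD d), MeasurableSet A → μ (A ×ˢ (Set.univ : Set (Ek k))) = volume A

/-- The outer integral `∫* g dx = inf { ∫ G dx : G Borel measurable, g ≤ G }` of a
`[0,∞]`-valued function on `𝕋^d`. -/
def outerIntegral (d : ℕ) (h : TorusD d → ℝ≥0∞) : ℝ≥0∞ :=
  ⨅ (G : TorusD d → ℝ≥0∞) (_ : Measurable G) (_ : ∀ x, h x ≤ G x), ∫⁻ x, G x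

open ProbabilityTheory in
theorem ym_eq_compProd (d k : ℕ)
    (μ : Measure (Sp d k)) [IsFiniteMeasure μ]
    (κ : Kernel (TorusD d) (Ek k)) [IsMarkovKernel κ]
    (hdisint : ∀ f : BoundedContinuousFunction (Sp d k) ℝ,
      (∫ p, f p ∂μ) = ∫ x, (∫ b, f (x, b) ∂(κ x)) ∂volume) :
    μ = (volume : Measure (TorusD d)) ⊗ₘ κ := by
  apply ext_of_forall_integral_eq_of_IsFiniteMeasure
  intro f
  rw [hdisint f, Measure.integral_compProd]
  exact f.integrable _

/-- Truncation estimate. -/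
theorem ym_trunc (d k : ℕ) (A : TorusD d → Set (Ek k)) (hA : ∀ x, IsCompact (A x))
    (ε : ℝ≥0∞) (hε : 0 < ε) :
    ∃ M : ℕ, ∀ ν : TorusD d → Measure (Ek k), (∀ x, IsProbabilityMeasure (ν x)) →
      (∀ E : Set (Ek k), MeasurableSet E → Measurable fun x => ν x E) →
      outerIntegral d (fun x => ν x (A x)ᶜ) < ε →
      ∫⁻ x, ν x (Metric.closedBall 0 M)ᶜ ≤ ε + ε := by
  let S : ℕ → Set (TorusD d) := fun M => {x | A x ⊆ Metric.closedBall 0 (M : ℝ)}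
  have hmono : Monotone S := by
    intro m n hmn x hx
    exact Set.Subset.trans hx (Metric.closedBall_subset_closedBall (by exact_mod_cast hmn))
  have hU : ⋃ M, S M = Set.univ := by
    ext x
    simp only [Set.mem_iUnion, Set.mem_univ, iff_true]
    obtain ⟨r, hr⟩ := (hA x).isBounded.subset_closedBall (0 : Ek k)
    obtain ⟨n, hn⟩ := exists_nat_ge r
    exact ⟨n, hr.trans (Metric.closedBall_subset_closedBall hn)⟩
  have hlim : Tendsto (fun M => volume (S M)) atTop (𝓝 (volume (Set.univ : Set (TorusD d)))) := by
    rw [← hU]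
    exact tendsto_measure_iUnion_atTop hmono
  have hVtop : volume (Set.univ : Set (TorusD d)) ≠ ∞ := measure_ne_top _ _
  obtain ⟨M, hM⟩ : ∃ M, volume (Set.univ : Set (TorusD d)) ≤ volume (S M) + ε := by
    have h2 : Tendsto (fun M => volume (S M) + ε) atTop
        (𝓝 (volume (Set.univ : Set (TorusD d)) + ε)) := hlim.add_const ε
    have h3 := h2.eventually (lt_mem_nhds (ENNReal.lt_add_right hVtop hε.ne'))
    obtain ⟨M, hM⟩ := h3.exists
    exact ⟨M, hM.le⟩
  refine ⟨M, fun ν hp hm ho => ?_⟩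
  simp only [outerIntegral, iInf_lt_iff] at ho
  obtain ⟨G, hG, hle, hint⟩ := ho
  have hmb := hm _ (Metric.isClosed_closedBall (x := (0 : Ek k)) (ε := (M : ℝ))).measurableSet.compl
  set g : TorusD d → ℝ≥0∞ := fun x => ν x (Metric.closedBall 0 (M : ℝ))ᶜ with hg
  let T : Set (TorusD d) := {x | g x ≤ G x}
  have hT : MeasurableSet T := measurableSet_le hmb hG
  have hST : S M ⊆ T := fun x hx =>
    (measure_mono (Set.compl_subset_compl.2 hx)).trans (hle x)
  have hTc : volume Tᶜ ≤ ε := by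
    rw [measure_compl hT (measure_ne_top _ _)]
    refine tsub_le_iff_left.2 (hM.trans ?_)
    gcongr
  rw [← lintegral_add_compl g hT]
  gcongr
  · calc ∫⁻ x in T, g x ≤ ∫⁻ x in T, G x := setLIntegral_mono hG (fun x hx => hx)
      _ ≤ ∫⁻ x, G x := setLIntegral_le_lintegral _ _
      _ ≤ ε := hint.le
  · calc ∫⁻ x in Tᶜ, g x ≤ ∫⁻ x in Tᶜ, 1 := by
          refine setLIntegral_mono measurable_const (fun x _ => ?_)
          have := hp x
          exact prob_le_one
      _ ≤ ε := by simpa using hTc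

/-- (Compactness of Young measures.) Let `(μ_n)` be Young measures on
`𝕋^d × ℝ^k` with disintegrations `(ν_n^x)_x`. If for every `δ > 0` there is a family of
compact sets `(A_x)_x` in `ℝ^k` with `sup_n ∫*_{𝕋^d} ν_n^x(A_xᶜ) dx < δ`, then some
subsequence converges to a Young measure `μ` in the sense of Young measures. -/
theorem young_measures_compactness (d k : ℕ) (hd : 1 ≤ d) (hk : 1 ≤ k)
    (μ : ℕ → Measure (Sp d k)) (hY : ∀ n, IsYoungMeasure d k (μ n))
    (ν : ℕ → TorusD d → Measure (Ek k))
    (hprob : ∀ n x, IsProbabilityMeasure (ν n x))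
    (hmeas : ∀ n, ∀ E : Set (Ek k), MeasurableSet E → Measurable fun x => ν n x E)
    (hdisint : ∀ n, ∀ f : BoundedContinuousFunction (Sp d k) ℝ,
      (∫ p, f p ∂(μ n)) = ∫ x, (∫ b, f (x, b) ∂(ν n x)) ∂volume)
    (htight : ∀ δ : ℝ, 0 < δ → ∃ A : TorusD d → Set (Ek k),
      (∀ x, IsCompact (A x)) ∧
      (⨆ n, outerIntegral d fun x => ν n x (A x)ᶜ) < ENNReal.ofReal δ) :
    ∃ φ : ℕ → ℕ, StrictMono φ ∧ ∃ μ' : Measure (Sp d k), IsYoungMeasure d k μ' ∧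
      ∀ f : BoundedContinuousFunction (Sp d k) ℝ,
        Tendsto (fun j => ∫ p, f p ∂(μ (φ j))) atTop (𝓝 (∫ p, f p ∂μ')) := by
  set V : ℝ≥0∞ := volume (Set.univ : Set (TorusD d)) with hV
  have hVtop : V ≠ ∞ := measure_ne_top _ _
  have hV0 : V ≠ 0 := by
    rw [hV]
    exact (isOpen_univ.measure_pos volume Set.univ_nonempty).ne'
  have huniv : ∀ n, μ n Set.univ = V := by
    intro n
    rw [← Set.univ_prod_univ]
    exact hY n _ MeasurableSet.univ
  have hfin : ∀ n, IsFiniteMeasure (μ n) := fun n => ⟨by rw [huniv]; exact hVtop.lt_top⟩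
  have htail : ∀ ε : ℝ≥0∞, 0 < ε → ∃ M : ℕ, ∀ n,
      μ n ((Set.univ : Set (TorusD d)) ×ˢ Metric.closedBall (0 : Ek k) M)ᶜ ≤ ε := by
    intro ε hε
    obtain ⟨δ, hδ0, hδ⟩ : ∃ δ : ℝ, 0 < δ ∧ ENNReal.ofReal δ + ENNReal.ofReal δ ≤ ε := by
      by_cases h : ε = ∞
      · exact ⟨1, one_pos, by simp [h]⟩
      · have hp := ENNReal.toReal_pos hε.ne' h
        refine ⟨ε.toReal / 2, by linarith, ?_⟩
        rw [← ENNReal.ofReal_add (by linarith) (by linarith), add_halves, ENNReal.ofReal_toReal h]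
    obtain ⟨A, hA, hs⟩ := htight δ hδ0
    obtain ⟨M, hM⟩ := ym_trunc d k A hA (ENNReal.ofReal δ) (by simpa using hδ0)
    refine ⟨M, fun n => ?_⟩
    have h1 := hM (ν n) (hprob n) (hmeas n)
      (lt_of_le_of_lt (le_iSup (fun n => outerIntegral d fun x => ν n x (A x)ᶜ) n) hs)
    let κ : ProbabilityTheory.Kernel (TorusD d) (Ek k) :=
      ⟨ν n, Measure.measurable_of_measurable_coe _ (hmeas n)⟩
    haveI : ProbabilityTheory.IsMarkovKernel κ := ⟨fun x => hprob n x⟩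
    have hE : MeasurableSet
        ((Set.univ : Set (TorusD d)) ×ˢ Metric.closedBall (0 : Ek k) M)ᶜ :=
      (MeasurableSet.univ.prod Metric.isClosed_closedBall.measurableSet).compl
    rw [ym_eq_compProd d k (μ n) κ (hdisint n), Measure.compProd_apply hE]
    refine le_trans (le_of_eq ?_) (h1.trans hδ)
    refine lintegral_congr (fun x => ?_)
    show ν n x _ = ν n x _
    congr 1
    ext b
    simp
  have hPprob : ∀ n, IsProbabilityMeasure (V⁻¹ • μ n) := fun n =>
    ⟨by simp [huniv, ENNReal.inv_mul_cancel hV0 hVtop]⟩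
  let P : ℕ → ProbabilityMeasure (Sp d k) := fun n => ⟨V⁻¹ • μ n, hPprob n⟩
  have hcomp : IsCompact (closure (Set.range P)) := by
    apply isCompact_closure_of_isTightMeasureSet
    rw [isTightMeasureSet_iff_exists_isCompact_measure_compl_le]
    intro ε hε
    obtain ⟨M, hM⟩ := htail (V * ε) (ENNReal.mul_pos hV0 hε.ne')
    refine ⟨_, isCompact_univ.prod (isCompact_closedBall (0 : Ek k) M), ?_⟩
    rintro _ ⟨_, ⟨n, rfl⟩, rfl⟩
    show (V⁻¹ • μ n) _ ≤ ε
    rw [Measure.smul_apply, smul_eq_mul]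
    calc _ ≤ V⁻¹ * (V * ε) := by gcongr; exact hM n
      _ = ε := by rw [← mul_assoc, ENNReal.inv_mul_cancel hV0 hVtop, one_mul]
  obtain ⟨Q, -, φ, hφ, hQ⟩ := hcomp.tendsto_subseq (x := P)
    (fun n => subset_closure (Set.mem_range_self n))
  have hsm : ∀ ρ : Measure (Sp d k), V • (V⁻¹ • ρ) = ρ := fun ρ => by
    rw [smul_smul, ENNReal.mul_inv_cancel hV0 hVtop, one_smul]
  refine ⟨φ, hφ, V • (Q : Measure (Sp d k)), ?_, ?_⟩
  · have hvp : IsProbabilityMeasure (V⁻¹ • (volume : Measure (TorusD d))) :=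
      ⟨by simp [← hV, ENNReal.inv_mul_cancel hV0 hVtop]⟩
    let R : ProbabilityMeasure (TorusD d) := ⟨V⁻¹ • volume, hvp⟩
    have hmap := ProbabilityMeasure.tendsto_map_of_tendsto_of_continuous _ _ hQ
      (continuous_fst : Continuous (Prod.fst : Sp d k → TorusD d))
    have hc : ∀ j, ((P ∘ φ) j).map continuous_fst.measurable.aemeasurable = R := by
      intro j
      apply Subtype.ext
      ext A hA
      show Measure.map Prod.fst (V⁻¹ • μ (φ j)) A = (V⁻¹ • volume) A
      rw [Measure.map_apply measurable_fst hA, Measure.smul_apply, Measure.smul_apply,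
        ← hY (φ j) A hA, Set.prod_univ]
    simp only [hc] at hmap
    have hR := tendsto_nhds_unique hmap tendsto_const_nhds
    intro A hA
    have h2 : Measure.map Prod.fst (Q : Measure (Sp d k)) = V⁻¹ • volume :=
      congrArg Subtype.val hR
    rw [Set.prod_univ, Measure.smul_apply, ← Measure.map_apply measurable_fst hA, h2,
      Measure.smul_apply, smul_eq_mul, smul_eq_mul, ← mul_assoc,
      ENNReal.mul_inv_cancel hV0 hVtop, one_mul]
  · intro f
    have h := (ProbabilityMeasure.tendsto_iff_forall_integral_tendsto.1 hQ f).const_mul V.toReal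
    rw [integral_smul_measure]
    refine h.congr (fun j => ?_)
    show V.toReal * ∫ p, f p ∂(V⁻¹ • μ (φ j)) = _
    conv_rhs => rw [← hsm (μ (φ j)), integral_smul_measure]
    rfl
end
end

section
/- Fix T > 0 and families of strictly positive real numbers (R_k)_{k∈ℕ} and (θ_{k,i})_{k,i∈ℕ}. Let K be the set of all continuous maps μ : [0,T] → 𝒴 (with 𝒴 the space of Young measures on 𝕋^d × ℝ^k endowed with the metric ρ) such that for every k ∈ ℕ: (a) sup_{t∈[0,T]} ∫*_{𝕋^d} μ_t^x( { b ∈ ℝ^k : |b| > R_k } ) dx ≤ 1/k, where (μ_t^x)_x is a disintegration of μ_t with respect to Lebesgue measure on 𝕋^d and ∫* is the outer integral; and (b) sup_{i∈ℕ} sup_{|t−s|<θ_{k,i}} | ∫ g_i d(μ_t − μ_s) | ≤ 1/k. Then K is relatively compact in C([0,T]; 𝒴) for the uniform metric d(u,v) = sup_{t∈[0,T]} ρ(u_t, v_t). -/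
open MeasureTheory Filter Topology
open scoped ENNReal

noncomputable section

/-- The family `𝒜 = { x ↦ (a − b·dist(x, xⁿ)) ⊔ c : a,b,c ∈ ℚ, b ≥ 0, n ∈ ℕ }`. -/
def SetA (d k : ℕ) (xseq : ℕ → Sp d k) : Set (Sp d k → ℝ) :=
  {f | ∃ (a b c : ℚ) (n : ℕ), 0 ≤ b ∧
    f = fun y => max ((a : ℝ) - (b : ℝ) * dist y (xseq n)) (c : ℝ)}

/-- The family `𝐀` of finite pointwise maxima of elements of `𝒜`. -/
def SetAA (d k : ℕ) (xseq : ℕ → Sp d k) : Set (Sp d k → ℝ) :=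
  {f | ∃ (m : ℕ) (fs : Fin (m + 1) → Sp d k → ℝ),
    (∀ i, fs i ∈ SetA d k xseq) ∧ f = fun y => ⨆ i, fs i y}

/-- The family `𝒢 = { g ∈ 𝐀 ∪ (−𝐀) : sup |g| ≤ 1 }`. -/
def SetG (d k : ℕ) (xseq : ℕ → Sp d k) : Set (Sp d k → ℝ) :=
  {g | (g ∈ SetAA d k xseq ∨ -g ∈ SetAA d k xseq) ∧ ∀ y, |g y| ≤ 1}

/-- `ρ(μ,ν) = Σ_i 2^{−i} |∫ g_i dμ − ∫ g_i dν|` for a fixed enumeration `(g_i)` of `𝒢`. -/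
def rho (d k : ℕ) (g : ℕ → Sp d k → ℝ) (μ ν : Measure (Sp d k)) : ℝ :=
  ∑' i : ℕ, (1 / 2 : ℝ) ^ i * |(∫ y, g i y ∂μ) - ∫ y, g i y ∂ν|

/-- Membership in the set `K`: `μ : [0,T] → 𝒴` is continuous for the metric `ρ`, each `μ_t`
is a Young measure, and for every `m ≥ 1`:
(a) `sup_{t∈[0,T]} ∫*_{𝕋^d} μ_t^x({b : |b| > R_m}) dx ≤ 1/m` for a disintegration
`(μ_t^x)_x` of `μ_t`; and
(b) `sup_i sup_{|t−s|<θ_{m,i}} |∫ g_i d(μ_t − μ_s)| ≤ 1/m`. -/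
def MemK (d k : ℕ) (g : ℕ → Sp d k → ℝ) (T : ℝ) (R : ℕ → ℝ) (θ : ℕ → ℕ → ℝ)
    (μ : ℝ → Measure (Sp d k)) : Prop :=
  (∀ t ∈ Set.Icc (0 : ℝ) T, IsYoungMeasure d k (μ t)) ∧
  (∀ t ∈ Set.Icc (0 : ℝ) T, ∀ ε > (0 : ℝ), ∃ δ > (0 : ℝ), ∀ s ∈ Set.Icc (0 : ℝ) T,
      |s - t| < δ → rho d k g (μ s) (μ t) < ε) ∧
  (∀ m : ℕ, 1 ≤ m →
    (∃ ν : ℝ → TorusD d → Measure (Ek k),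
      (∀ t ∈ Set.Icc (0 : ℝ) T,
        (∀ x, IsProbabilityMeasure (ν t x)) ∧
        (∀ E : Set (Ek k), MeasurableSet E → Measurable fun x => ν t x E) ∧
        (∀ f : BoundedContinuousFunction (Sp d k) ℝ,
          (∫ p, f p ∂(μ t)) = ∫ x, (∫ b, f (x, b) ∂(ν t x)) ∂volume)) ∧
      (⨆ t : Set.Icc (0 : ℝ) T,
          outerIntegral d fun x => ν t x {b : Ek k | R m < ‖b‖}) ≤ (m : ℝ≥0∞)⁻¹) ∧
    (∀ i : ℕ, ∀ t ∈ Set.Icc (0 : ℝ) T, ∀ s ∈ Set.Icc (0 : ℝ) T, |t - s| < θ m i →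
      |(∫ p, g i p ∂(μ t)) - ∫ p, g i p ∂(μ s)| ≤ 1 / (m : ℝ)))


theorem aux_univ {d k : ℕ} {μ : Measure (Sp d k)} (h : IsYoungMeasure d k μ) :
    μ Set.univ = volume (Set.univ : Set (TorusD d)) := by
  have := h Set.univ MeasurableSet.univ
  rwa [Set.univ_prod_univ] at this

theorem aux_finite {d k : ℕ} {μ : Measure (Sp d k)} (h : IsYoungMeasure d k μ) :
    IsFiniteMeasure μ := ⟨by rw [aux_univ h]; exact measure_lt_top _ _⟩

theorem aux_SetAA {d k : ℕ} {xseq : ℕ → Sp d k} {f : Sp d k → ℝ} (h : f ∈ SetAA d k xseq) :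
    Continuous f := by
  obtain ⟨m, fs, hfs, rfl⟩ := h
  have h1 : ∀ i, Continuous (fs i) := by
    intro i
    obtain ⟨a, b, c, n, -, h⟩ := hfs i
    rw [h]
    fun_prop
  have h2 : (fun y => ⨆ i, fs i y) =
      fun y => Finset.univ.sup' Finset.univ_nonempty (fun i => fs i y) := by
    funext y
    rw [Finset.sup'_univ_eq_ciSup]
  rw [h2]
  exact Continuous.finset_sup'_apply _ (fun i _ => h1 i)

theorem aux_SetG {d k : ℕ} {xseq : ℕ → Sp d k} {f : Sp d k → ℝ} (h : f ∈ SetG d k xseq) :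
    Continuous f := by
  rcases h.1 with h | h
  · exact aux_SetAA h
  · have := (aux_SetAA h).neg
    rwa [neg_neg] at this

theorem aux_tight {d k : ℕ} {μ : Measure (Sp d k)} [IsFiniteMeasure μ]
    (ν : TorusD d → Measure (Ek k)) (r : ℝ) (c : ℝ≥0∞) (hc : c ≠ ∞)
    (h1 : ∀ x, IsProbabilityMeasure (ν x))
    (h2 : ∀ E : Set (Ek k), MeasurableSet E → Measurable fun x => ν x E)
    (h3 : ∀ f : BoundedContinuousFunction (Sp d k) ℝ,
          (∫ p, f p ∂μ) = ∫ x, (∫ b, f (x, b) ∂(ν x)) ∂volume)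
    (h4 : outerIntegral d (fun x => ν x {b : Ek k | r < ‖b‖}) ≤ c) :
    μ (Set.univ ×ˢ Metric.closedBall (0 : Ek k) (r + 1))ᶜ ≤ c := by
  have hE : MeasurableSet {b : Ek k | r < ‖b‖} :=
    (isOpen_lt continuous_const continuous_norm).measurableSet
  have hm := h2 _ hE
  have h5 : ∫⁻ x, ν x {b : Ek k | r < ‖b‖} ≤ c := by
    refine le_trans ?_ h4
    unfold outerIntegral
    refine le_iInf fun G => le_iInf fun _ => le_iInf fun hG => lintegral_mono hG
  have hb : ∀ y : Sp d k, ‖min 1 (max 0 (‖y.2‖ - r))‖ ≤ 1 := by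
    intro y
    rw [Real.norm_eq_abs, abs_le]
    constructor
    · have : (0:ℝ) ≤ min 1 (max 0 (‖y.2‖ - r)) := by positivity
      linarith
    · exact min_le_left _ _
  let f : BoundedContinuousFunction (Sp d k) ℝ :=
    BoundedContinuousFunction.ofNormedAddCommGroup
      (fun y : Sp d k => min 1 (max 0 (‖y.2‖ - r))) (by fun_prop) 1 hb
  have hf : ∀ y, f y = min 1 (max 0 (‖y.2‖ - r)) := fun y => rfl
  have hf0 : ∀ y, 0 ≤ f y := fun y => by rw [hf]; positivity
  have h6 := h3 f
  have hint : Integrable (fun x => (ν x {b : Ek k | r < ‖b‖}).toReal)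
      (volume : Measure (TorusD d)) := by
    refine Integrable.of_bound hm.ennreal_toReal.aestronglyMeasurable 1 (ae_of_all _ fun x => ?_)
    rw [Real.norm_of_nonneg ENNReal.toReal_nonneg]
    exact ENNReal.toReal_le_of_le_ofReal zero_le_one (by simpa using prob_le_one)
  have h7 : ∫ x, (∫ b, f (x, b) ∂(ν x)) ≤ ∫ x, (ν x {b : Ek k | r < ‖b‖}).toReal := by
    refine integral_mono_of_nonneg (ae_of_all _ fun x => integral_nonneg fun b => hf0 _) hint
      (ae_of_all _ fun x => ?_)
    have := integral_indicator_one (μ := ν x) hE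
    change _ ≤ (ν x).real _
    rw [← this]
    refine integral_mono_of_nonneg (ae_of_all _ fun b => hf0 _)
      ((integrable_const (1:ℝ)).indicator hE) (ae_of_all _ fun b => ?_)
    simp only [hf]
    by_cases hbr : r < ‖b‖
    · rw [Set.indicator_of_mem (by exact hbr)]
      exact min_le_left _ _
    · rw [Set.indicator_of_notMem (by exact hbr)]
      rw [max_eq_left (by linarith)]
      exact min_le_right _ _
  have h8 : ∫ x, (ν x {b : Ek k | r < ‖b‖}).toReal ≤ c.toReal := by
    rw [integral_toReal hm.aemeasurable (ae_of_all _ fun x => measure_lt_top _ _)]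
    exact ENNReal.toReal_mono hc h5
  have hS : MeasurableSet (Set.univ ×ˢ Metric.closedBall (0 : Ek k) (r + 1) : Set (Sp d k))ᶜ :=
    (MeasurableSet.univ.prod measurableSet_closedBall).compl
  have h9 : μ.real (Set.univ ×ˢ Metric.closedBall (0 : Ek k) (r + 1))ᶜ ≤ ∫ p, f p ∂μ := by
    rw [← integral_indicator_one hS]
    refine integral_mono_of_nonneg (ae_of_all _ fun b => ?_) (f.integrable μ)
      (ae_of_all _ fun b => ?_)
    · exact Set.indicator_nonneg (fun _ _ => zero_le_one) _
    · by_cases hbr : b ∈ (Set.univ ×ˢ Metric.closedBall (0 : Ek k) (r + 1) : Set (Sp d k))ᶜ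
      · have h10 : r + 1 < ‖b.2‖ := by simpa using hbr
        rw [Set.indicator_of_mem hbr, hf, max_eq_right (by linarith), min_eq_left (by linarith)]
        rfl
      · rw [Set.indicator_of_notMem hbr]
        exact hf0 _
  rw [← ENNReal.ofReal_toReal hc]
  rw [← ofReal_measureReal]
  exact ENNReal.ofReal_le_ofReal (by linarith)

/-- Prokhorov part. -/
theorem aux_limit {d k : ℕ} (g : ℕ → Sp d k → ℝ) (hgc : ∀ i, Continuous (g i))
    (hgb : ∀ i y, |g i y| ≤ 1) (R : ℕ → ℝ) (μ : ℕ → Measure (Sp d k))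
    (hY : ∀ n, IsYoungMeasure d k (μ n))
    (ht : ∀ n m : ℕ, 1 ≤ m →
      μ n (Set.univ ×ˢ Metric.closedBall (0 : Ek k) (R m + 1))ᶜ ≤ (m : ℝ≥0∞)⁻¹)
    (F : ℕ → ℝ) (hF : ∀ i, Tendsto (fun n => ∫ y, g i y ∂(μ n)) atTop (𝓝 (F i))) :
    ∃ ν : Measure (Sp d k), IsYoungMeasure d k ν ∧ ∀ i, ∫ y, g i y ∂ν = F i := by
  let μ' : ℕ → FiniteMeasure (Sp d k) := fun n => ⟨μ n, aux_finite (hY n)⟩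
  let u : ℕ → NNReal := fun n => ((n + 1 : ℕ) : NNReal)⁻¹
  have hu : Tendsto u atTop (𝓝 0) :=
    (tendsto_inv_atTop_nhds_zero_nat (𝕜 := NNReal)).comp (tendsto_add_atTop_nat 1)
  have hcomp := isCompact_setOfPred_finiteMeasure_mass_le_compl_isCompact_le (E := Sp d k)
    (u := u) (K := fun n => Set.univ ×ˢ Metric.closedBall (0 : Ek k) (R (n + 1) + 1))
    (volume (Set.univ : Set (TorusD d))).toNNReal hu
    (fun n => isCompact_univ.prod (isCompact_closedBall _ _)) (Or.inl inferInstance)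
  have hmem : ∀ n, μ' n ∈ {μ : FiniteMeasure (Sp d k) |
      μ.mass ≤ (volume (Set.univ : Set (TorusD d))).toNNReal ∧
      ∀ n, μ (Set.univ ×ˢ Metric.closedBall (0 : Ek k) (R (n + 1) + 1))ᶜ ≤ u n} := by
    intro n
    constructor
    · rw [← ENNReal.coe_le_coe, FiniteMeasure.ennreal_mass, ENNReal.coe_toNNReal
        (measure_ne_top _ _)]
      exact (aux_univ (hY n)).le
    · intro m
      rw [← ENNReal.coe_le_coe, FiniteMeasure.ennreal_coeFn_eq_coeFn_toMeasure]
      refine (ht n (m + 1) (by omega)).trans ?_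
      simp only [u]
      rw [ENNReal.coe_inv (by positivity)]
      simp
  let U : Ultrafilter ℕ := hyperfilter ℕ
  have hU : (U : Filter ℕ) ≤ atTop := Nat.hyperfilter_le_atTop
  obtain ⟨ν, -, hν⟩ := isCompact_iff_ultrafilter_le_nhds'.1 hcomp (U.map μ')
    (Ultrafilter.mem_map.2 (Filter.mem_of_superset Filter.univ_mem fun n _ => hmem n))
  have hν : Tendsto μ' U (𝓝 ν) := hν
  refine ⟨ν, ?_, fun i => ?_⟩
  · let v : FiniteMeasure (TorusD d) := ⟨volume, inferInstance⟩
    have h1 : ∀ n, (μ' n).map Prod.fst = v := by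
      intro n
      apply Subtype.ext
      ext A hA
      change ((μ' n).map Prod.fst : Measure (TorusD d)) A = volume A
      rw [FiniteMeasure.toMeasure_map, Measure.map_apply measurable_fst hA]
      have := hY n A hA
      rw [Set.prod_univ] at this
      exact this
    have h2 := FiniteMeasure.tendsto_map_of_tendsto_of_continuous _ _ hν
      (continuous_fst (X := TorusD d) (Y := Ek k))
    simp only [h1] at h2
    have h3 : ν.map Prod.fst = v := tendsto_nhds_unique h2 tendsto_const_nhds
    intro A hA
    have h4 : (ν.map Prod.fst : Measure (TorusD d)) A = volume A := by rw [h3]; rfl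
    rw [FiniteMeasure.toMeasure_map, Measure.map_apply measurable_fst hA] at h4
    rw [Set.prod_univ]
    exact h4
  · have h1 := FiniteMeasure.tendsto_iff_forall_integral_tendsto.1 hν
      (BoundedContinuousFunction.ofNormedAddCommGroup (g i) (hgc i) 1 (hgb i))
    exact tendsto_nhds_unique h1 ((hF i).mono_left hU)

/-- Arzela-Ascoli part. -/
theorem aux_ascoli (T : ℝ) (θ : ℕ → ℕ → ℝ) (hθ : ∀ m i, 0 < θ m i) (C : ℝ)
    (G : ℕ → ℕ → ℝ → ℝ)
    (hC : ∀ n i, ∀ t ∈ Set.Icc (0:ℝ) T, |G n i t| ≤ C)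
    (hG : ∀ n i m, 1 ≤ m → ∀ t ∈ Set.Icc (0:ℝ) T, ∀ s ∈ Set.Icc (0:ℝ) T, |t - s| < θ m i →
      |G n i t - G n i s| ≤ 1 / (m : ℝ)) :
    ∃ φ : ℕ → ℕ, StrictMono φ ∧ ∃ F : ℕ → BoundedContinuousFunction (Set.Icc (0:ℝ) T) ℝ,
      ∃ e : ℕ → ℕ → ℝ, (∀ i, Tendsto (e i) atTop (𝓝 0)) ∧
        ∀ i j (t : Set.Icc (0:ℝ) T), |G (φ j) i t - F i t| ≤ e i j := by
  have key : ∀ i, ∀ ε > (0:ℝ), ∃ δ > 0, ∀ n, ∀ t s : Set.Icc (0:ℝ) T, dist t s < δ →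
      dist (G n i t) (G n i s) < ε := by
    intro i ε hε
    obtain ⟨m, hm⟩ := exists_nat_one_div_lt hε
    refine ⟨θ (m+1) i, hθ _ _, fun n t s hts => ?_⟩
    rw [Real.dist_eq]
    refine lt_of_le_of_lt (hG n i (m+1) (by omega) t t.2 s s.2 hts) ?_
    push_cast
    exact hm
  have hcont : ∀ n i, Continuous (fun t : Set.Icc (0:ℝ) T => G n i t) := by
    intro n i
    rw [Metric.continuous_iff]
    intro b ε hε
    obtain ⟨δ, hδ, h⟩ := key i ε hε
    exact ⟨δ, hδ, fun a ha => h n a b ha⟩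
  let B : ℕ → ℕ → BoundedContinuousFunction (Set.Icc (0:ℝ) T) ℝ := fun n i =>
    BoundedContinuousFunction.ofNormedAddCommGroup (fun t : Set.Icc (0:ℝ) T => G n i t)
      (hcont n i) C (fun t => hC n i t t.2)
  have hcomp : ∀ i, IsCompact (closure (Set.range fun n => B n i)) := by
    intro i
    refine BoundedContinuousFunction.arzela_ascoli (Set.Icc (-C) C) isCompact_Icc _ ?_ ?_
    · rintro f x ⟨n, rfl⟩
      exact abs_le.1 (hC n i x x.2)
    · intro x
      rw [Metric.equicontinuousAt_iff]
      intro ε hε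
      obtain ⟨δ, hδ, h⟩ := key i ε hε
      refine ⟨δ, hδ, ?_⟩
      rintro y hy ⟨_, n, rfl⟩
      exact h n x y (by rwa [dist_comm])
  have hpi := isCompact_univ_pi hcomp
  obtain ⟨F, -, φ, hφ, hF⟩ := hpi.tendsto_subseq (x := B)
    (fun n i _ => subset_closure ⟨n, rfl⟩)
  refine ⟨φ, hφ, F, fun i j => dist (B (φ j) i) (F i), fun i => ?_, fun i j t => ?_⟩
  · have := (tendsto_pi_nhds.1 hF i)
    exact tendsto_iff_dist_tendsto_zero.1 this
  · exact BoundedContinuousFunction.dist_coe_le_dist (f := B (φ j) i) (g := F i) t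

theorem aux_geom : Summable (fun i : ℕ => (1/2:ℝ)^i) := summable_geometric_two

/-- The set `K` is relatively compact in `C([0,T];𝒴)` for the uniform
metric `d(u,v) = sup_{t∈[0,T]} ρ(u_t,v_t)`: every sequence in `K` admits a subsequence
converging uniformly (in `ρ`) to a `ρ`-continuous Young-measure-valued path. -/
theorem K_relatively_compact (d k : ℕ) (hd : 1 ≤ d) (hk : 1 ≤ k)
    (xseq : ℕ → Sp d k) (hdense : DenseRange xseq)
    (g : ℕ → Sp d k → ℝ) (hg : Set.range g = SetG d k xseq)
    (T : ℝ) (hT : 0 < T)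
    (R : ℕ → ℝ) (hR : ∀ m, 0 < R m) (θ : ℕ → ℕ → ℝ) (hθ : ∀ m i, 0 < θ m i) :
    ∀ seq : ℕ → ℝ → Measure (Sp d k), (∀ n, MemK d k g T R θ (seq n)) →
      ∃ φ : ℕ → ℕ, StrictMono φ ∧ ∃ ν : ℝ → Measure (Sp d k),
        (∀ t ∈ Set.Icc (0 : ℝ) T, IsYoungMeasure d k (ν t)) ∧
        (∀ t ∈ Set.Icc (0 : ℝ) T, ∀ ε > (0 : ℝ), ∃ δ > (0 : ℝ), ∀ s ∈ Set.Icc (0 : ℝ) T,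
          |s - t| < δ → rho d k g (ν s) (ν t) < ε) ∧
        (∀ ε > (0 : ℝ), ∃ N : ℕ, ∀ j ≥ N, ∀ t ∈ Set.Icc (0 : ℝ) T,
          rho d k g (seq (φ j) t) (ν t) < ε) := by
  intro seq hseq
  have hgG : ∀ i, g i ∈ SetG d k xseq := fun i => hg ▸ Set.mem_range_self i
  have hgc : ∀ i, Continuous (g i) := fun i => aux_SetG (hgG i)
  have hgb : ∀ i y, |g i y| ≤ 1 := fun i => (hgG i).2
  set C : ℝ := (volume (Set.univ : Set (TorusD d))).toReal with hCdef
  have hgC : ∀ (μ : Measure (Sp d k)), IsYoungMeasure d k μ → ∀ i, |∫ y, g i y ∂μ| ≤ C := by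
    intro μ hμ i
    have := aux_finite hμ
    have h := norm_integral_le_of_norm_le_const (μ := μ) (f := g i) (C := 1)
      (ae_of_all _ (hgb i))
    rw [one_mul, measureReal_def, aux_univ hμ] at h
    exact h
  obtain ⟨φ, hφ, F, e, he, hFe⟩ := aux_ascoli T θ hθ C
    (fun n i t => ∫ y, g i y ∂(seq n t))
    (fun n i t ht => hgC _ ((hseq n).1 t ht) i)
    (fun n i m hm t ht s hs h => ((hseq n).2.2 m hm).2 i t ht s hs h)
  have hlim : ∀ t : Set.Icc (0:ℝ) T, ∃ ν : Measure (Sp d k), IsYoungMeasure d k ν ∧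
      ∀ i, ∫ y, g i y ∂ν = F i t := by
    intro t
    refine aux_limit g hgc hgb R (fun j => seq (φ j) t) (fun j => (hseq _).1 t t.2) ?_ _ ?_
    · intro j m hm
      obtain ⟨⟨ν, hν, hsup⟩, -⟩ := (hseq (φ j)).2.2 m hm
      have := aux_finite ((hseq (φ j)).1 t t.2)
      obtain ⟨h1, h2, h3⟩ := hν t t.2
      refine aux_tight (ν t) (R m) _ ?_ h1 h2 h3 (le_trans (le_iSup
        (fun t : Set.Icc (0 : ℝ) T =>
          outerIntegral d fun x => ν t x {b : Ek k | R m < ‖b‖}) t) hsup)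
      simp
      omega
    · intro i
      rw [tendsto_iff_dist_tendsto_zero]
      exact squeeze_zero (fun _ => dist_nonneg) (fun j => hFe i j t) (he i)
  choose ν hνY hνF using hlim
  have hFC : ∀ i t, |F i t| ≤ C := fun i t => by rw [← hνF]; exact hgC _ (hνY t) i
  have hdiff : ∀ a b : ℝ, |a| ≤ C → |b| ≤ C → |a - b| ≤ 2 * C := fun a b ha hb => by
    have := abs_sub a b
    linarith
  have hsum : Summable (fun i : ℕ => (1/2:ℝ)^i * (2 * C)) := aux_geom.mul_right _
  refine ⟨φ, hφ, fun t => if h : t ∈ Set.Icc (0:ℝ) T then ν ⟨t, h⟩ else 0, ?_, ?_, ?_⟩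
  · intro t ht
    simp only [dif_pos ht]
    exact hνY _
  · intro t ht ε hε
    have htend : Tendsto (fun s : Set.Icc (0:ℝ) T =>
        ∑' i, (1/2:ℝ)^i * |F i s - F i ⟨t, ht⟩|) (𝓝 ⟨t, ht⟩) (𝓝 (∑' i : ℕ, (0:ℝ))) := by
      refine tendsto_tsum_of_dominated_convergence hsum (fun i => ?_)
        (Eventually.of_forall fun s i => ?_)
      · have : Continuous (fun s : Set.Icc (0:ℝ) T => (1/2:ℝ)^i * |F i s - F i ⟨t, ht⟩|) := by
          fun_prop
        have h := this.tendsto ⟨t, ht⟩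
        simpa using h
      · rw [Real.norm_of_nonneg (by positivity)]
        exact mul_le_mul_of_nonneg_left (hdiff _ _ (hFC _ _) (hFC _ _)) (by positivity)
    rw [tsum_zero] at htend
    have h2 := htend.eventually (gt_mem_nhds hε)
    obtain ⟨δ, hδ, h3⟩ := Metric.eventually_nhds_iff.1 h2
    refine ⟨δ, hδ, fun s hs hst => ?_⟩
    simp only [dif_pos ht, dif_pos hs, rho, hνF]
    exact h3 (y := ⟨s, hs⟩) hst
  · intro ε hε
    have htend : Tendsto (fun j : ℕ =>
        ∑' i, (1/2:ℝ)^i * min (e i j) (2 * C)) atTop (𝓝 (∑' i : ℕ, (0:ℝ))) := by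
      refine tendsto_tsum_of_dominated_convergence hsum (fun i => ?_)
        (Eventually.of_forall fun j i => ?_)
      · have h := ((he i).min (tendsto_const_nhds (x := 2 * C))).const_mul ((1/2:ℝ)^i)
        rw [min_eq_left (by positivity), mul_zero] at h
        exact h
      · have h0 : 0 ≤ e i j := (abs_nonneg _).trans (hFe i j ⟨0, le_rfl, hT.le⟩)
        have : 0 ≤ min (e i j) (2 * C) := le_min h0 (by positivity)
        rw [Real.norm_of_nonneg (by positivity)]
        exact mul_le_mul_of_nonneg_left (min_le_right _ _) (by positivity)
    rw [tsum_zero] at htend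
    obtain ⟨N, hN⟩ := eventually_atTop.1 (htend.eventually (gt_mem_nhds hε))
    refine ⟨N, fun j hj t ht => lt_of_le_of_lt ?_ (hN j hj)⟩
    simp only [dif_pos ht, rho, hνF]
    have hle : ∀ i, |(∫ y, g i y ∂(seq (φ j) t)) - F i ⟨t, ht⟩| ≤ min (e i j) (2 * C) :=
      fun i => le_min (hFe i j ⟨t, ht⟩) (hdiff _ _ (hgC _ ((hseq _).1 t ht) i) (hFC _ _))
    have hle2 : ∀ i, (1/2:ℝ)^i * |(∫ y, g i y ∂(seq (φ j) t)) - F i ⟨t, ht⟩|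
        ≤ (1/2:ℝ)^i * min (e i j) (2 * C) :=
      fun i => mul_le_mul_of_nonneg_left (hle i) (by positivity)
    have hs2 : Summable fun i => (1/2:ℝ)^i * min (e i j) (2 * C) :=
      Summable.of_nonneg_of_le
        (fun i => mul_nonneg (by positivity) ((abs_nonneg _).trans (hle i)))
        (fun i => mul_le_mul_of_nonneg_left (min_le_right _ _) (by positivity)) hsum
    exact Summable.tsum_le_tsum hle2
      (Summable.of_nonneg_of_le (fun i => by positivity) hle2 hs2) hs2
end
end

section
/- For n ∈ ℕ and b ∈ ℝ³ define ℒⁿ(b) := Σ_{k ∈ ℤ³∖{0}, n ≤ |k| ≤ 2n} ((b·k)² / |k|⁵) ( I − (k ⊗ k)/|k|² ), a 3×3 real matrix. Then ℒⁿ(b) converges, as n → ∞, to ℒ(b) := (8π log 2 / 15)(2|b|² I − b ⊗ b), uniformly on compact subsets of ℝ³; that is, for every compact K ⊆ ℝ³, sup_{b ∈ K} ‖ℒⁿ(b) − ℒ(b)‖ → 0 as n → ∞. -/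
open MeasureTheory

noncomputable section

/-- Euclidean norm on `ℝ³ = Fin 3 → ℝ`. -/
def enorm3 (b : Fin 3 → ℝ) : ℝ := Real.sqrt (∑ i, (b i) ^ 2)

/-- Euclidean norm of a lattice point `k ∈ ℤ³`, viewed as a vector of `ℝ³`. -/
def znorm3 (k : Fin 3 → ℤ) : ℝ := Real.sqrt (∑ i, ((k i : ℝ)) ^ 2)

open scoped Classical in
/-- The `(α,β)` entry of the matrix
`ℒⁿ(b) = Σ_{k ∈ ℤ³∖{0}, n ≤ |k| ≤ 2n} ((b·k)²/|k|⁵)(I − (k⊗k)/|k|²)`.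
The sum is written as a `tsum` over all of `ℤ³` of a function supported on the
(finite) spherical shell `n ≤ |k| ≤ 2n`. -/
def Ln (n : ℕ) (b : Fin 3 → ℝ) (α β : Fin 3) : ℝ :=
  ∑' k : Fin 3 → ℤ,
    if k ≠ 0 ∧ (n : ℝ) ≤ znorm3 k ∧ znorm3 k ≤ 2 * n then
      ((∑ i, b i * (k i : ℝ)) ^ 2 / znorm3 k ^ 5) *
        ((if α = β then (1 : ℝ) else 0) - (k α : ℝ) * (k β : ℝ) / znorm3 k ^ 2)
    else 0

/-- The `(α,β)` entry of `ℒ(b) = (8π log 2 / 15)(2|b|² I − b ⊗ b)`. -/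
def Lentry (b : Fin 3 → ℝ) (α β : Fin 3) : ℝ :=
  (8 * Real.pi * Real.log 2 / 15) *
    (2 * enorm3 b ^ 2 * (if α = β then (1 : ℝ) else 0) - b α * b β)


abbrev E3 := EuclideanSpace ℝ (Fin 3)

def SE : Set E3 := {y | 1 ≤ ‖y‖ ∧ ‖y‖ ≤ 2}

lemma SE_compact : IsCompact SE := by
  have h : SE = Metric.closedBall 0 2 ∩ {y : E3 | 1 ≤ ‖y‖} := by
    ext y; simp [SE, and_comm]
  rw [h]
  exact (isCompact_closedBall _ _).inter_right (isClosed_le continuous_const continuous_norm)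

lemma SE_integrable (p : E3 → ℝ) (hp : Continuous p) :
    Integrable (fun y => p y / ‖y‖ ^ 7) (volume.restrict SE) := by
  refine ContinuousOn.integrableOn_compact SE_compact ?_
  refine ContinuousOn.div hp.continuousOn (by fun_prop) ?_
  intro y hy
  have : 0 < ‖y‖ := lt_of_lt_of_le one_pos hy.1
  positivity

lemma SE_inv (A : E3 ≃ₗᵢ[ℝ] E3) (g : E3 → ℝ) :
    ∫ y in SE, g (A y) = ∫ y in SE, g y := by
  have h := A.measurePreserving.setIntegral_preimage_emb
    A.toHomeomorph.measurableEmbedding g SE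
  have h2 : A ⁻¹' SE = SE := by ext y; simp [SE]
  rw [h2] at h
  exact h

def Phi (c : E3) : ℝ := ∫ y in SE, (inner ℝ c y) ^ 4 / ‖y‖ ^ 7

lemma Phi_iso (A : E3 ≃ₗᵢ[ℝ] E3) (c : E3) : Phi (A c) = Phi c := by
  unfold Phi
  rw [← SE_inv A (fun y => (inner ℝ (A c) y) ^ 4 / ‖y‖ ^ 7)]
  simp

lemma Phi_smul (t : ℝ) (c : E3) : Phi (t • c) = t ^ 4 * Phi c := by
  unfold Phi
  rw [← integral_const_mul]
  congr 1; ext y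
  rw [real_inner_smul_left]; ring

lemma Phi_eq_of_norm {c d : E3} (h : ‖c‖ = ‖d‖) : Phi c = Phi d := by
  have := Submodule.reflection_sub h
  rw [← this, Phi_iso]

def e3 (i : Fin 3) : E3 := EuclideanSpace.single i 1

lemma Phi_eq (c : E3) : Phi c = Phi (e3 0) * (inner ℝ c c) ^ 2 := by
  have h : Phi c = Phi (‖c‖ • e3 0) := by
    apply Phi_eq_of_norm
    simp [norm_smul, e3]
  rw [h, Phi_smul, real_inner_self_eq_norm_sq]; ring

lemma polar_lem (a b c d : E3) :
    ∫ y in SE, (inner ℝ a y * inner ℝ b y * inner ℝ c y * inner ℝ d y) / ‖y‖ ^ 7 =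
      Phi (e3 0) / 3 * (inner ℝ a b * inner ℝ c d + inner ℝ a c * inner ℝ b d
        + inner ℝ a d * inner ℝ b c) := by
  have hI : ∀ c : E3, Integrable (fun y => (inner ℝ c y) ^ 4 / ‖y‖ ^ 7) (volume.restrict SE) :=
    fun c => SE_integrable _ (by fun_prop)
  have h : (fun y : E3 => (inner ℝ a y * inner ℝ b y * inner ℝ c y * inner ℝ d y) / ‖y‖ ^ 7) =
     fun y : E3 => (1/192 : ℝ) * (
        (inner ℝ (a + b + c + d) y) ^ 4 / ‖y‖ ^ 7 - (inner ℝ (a + b + c - d) y) ^ 4 / ‖y‖ ^ 7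
      - (inner ℝ (a + b - c + d) y) ^ 4 / ‖y‖ ^ 7 + (inner ℝ (a + b - c - d) y) ^ 4 / ‖y‖ ^ 7
      - (inner ℝ (a - b + c + d) y) ^ 4 / ‖y‖ ^ 7 + (inner ℝ (a - b + c - d) y) ^ 4 / ‖y‖ ^ 7
      + (inner ℝ (a - b - c + d) y) ^ 4 / ‖y‖ ^ 7 - (inner ℝ (a - b - c - d) y) ^ 4 / ‖y‖ ^ 7) := by
    ext y
    simp only [inner_add_left, inner_sub_left]
    ring
  have key : ∫ y in SE, (inner ℝ a y * inner ℝ b y * inner ℝ c y * inner ℝ d y) / ‖y‖ ^ 7 =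
     (1/192 : ℝ) * (Phi (a + b + c + d) - Phi (a + b + c - d)
      - Phi (a + b - c + d) + Phi (a + b - c - d)
      - Phi (a - b + c + d) + Phi (a - b + c - d)
      + Phi (a - b - c + d) - Phi (a - b - c - d)) := by
    rw [h, integral_const_mul]
    have h1 := (hI (a + b + c + d)).sub (hI (a + b + c - d))
    have h2 := h1.sub (hI (a + b - c + d))
    have h3 := h2.add (hI (a + b - c - d))
    have h4 := h3.sub (hI (a - b + c + d))
    have h5 := h4.add (hI (a - b + c - d))
    have h6 := h5.add (hI (a - b - c + d))
    congr 1
    refine (integral_sub h6 (hI _)).trans ?_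
    congr 1
    refine (integral_add h5 (hI _)).trans ?_
    congr 1
    refine (integral_add h4 (hI _)).trans ?_
    congr 1
    refine (integral_sub h3 (hI _)).trans ?_
    congr 1
    refine (integral_add h2 (hI _)).trans ?_
    congr 1
    refine (integral_sub h1 (hI _)).trans ?_
    congr 1
    exact integral_sub (hI _) (hI _)
  rw [key]
  simp only [Phi_eq (_ + _), Phi_eq (_ - _)]
  simp only [inner_add_left, inner_sub_left, inner_add_right, inner_sub_right,
    real_inner_comm a b, real_inner_comm a c, real_inner_comm a d, real_inner_comm b c,
    real_inner_comm b d, real_inner_comm c d]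
  ring

def dl (i j : Fin 3) : ℝ := if i = j then 1 else 0

lemma I4_eq (i j k l : Fin 3) :
    ∫ y in SE, (y i * y j * y k * y l) / ‖y‖ ^ 7 =
      Phi (e3 0) / 3 * (dl i j * dl k l + dl i k * dl j l + dl i l * dl j k) := by
  have h := polar_lem (e3 i) (e3 j) (e3 k) (e3 l)
  simp only [e3, EuclideanSpace.inner_single_left, PiLp.single_apply, map_one, one_mul] at h
  simpa [dl, e3] using h

lemma radial : ∫ y in SE, 1 / ‖y‖ ^ 3 = 4 * Real.pi * Real.log 2 := by
  have hm : MeasurableSet SE := SE_compact.isClosed.measurableSet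
  have h0 : ∫ y in SE, 1 / ‖y‖ ^ 3 =
      ∫ y : E3, (Set.Icc (1:ℝ) 2).indicator (fun r => 1 / r ^ 3) ‖y‖ := by
    rw [← integral_indicator hm]
    rfl
  rw [h0, integral_fun_norm_addHaar]
  have h1 : ∫ y in Set.Ioi (0:ℝ), y ^ (Module.finrank ℝ E3 - 1) •
      (Set.Icc (1:ℝ) 2).indicator (fun r => 1 / r ^ 3) y = Real.log 2 := by
    have : (fun y : ℝ => y ^ (Module.finrank ℝ E3 - 1) •
      (Set.Icc (1:ℝ) 2).indicator (fun r => 1 / r ^ 3) y) =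
        (Set.Icc (1:ℝ) 2).indicator (fun r => 1 / r) := by
      ext y
      by_cases hy : y ∈ Set.Icc (1:ℝ) 2
      · have : y ≠ 0 := by have := hy.1; positivity
        simp only [Set.indicator_of_mem hy, finrank_euclideanSpace, Fintype.card_fin, smul_eq_mul]
        field_simp
      · simp [Set.indicator_of_notMem hy]
    have hsub : Set.Icc (1:ℝ) 2 ⊆ Set.Ioi 0 := fun x hx => lt_of_lt_of_le one_pos hx.1
    rw [this, setIntegral_indicator measurableSet_Icc,
      Set.inter_eq_right.2 hsub,
      integral_Icc_eq_integral_Ioc, ← intervalIntegral.integral_of_le (by norm_num),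
      integral_one_div_of_pos (by norm_num) (by norm_num)]
    norm_num
  rw [h1]
  have hpi : (ENNReal.ofReal (Real.pi * 4 / 3)).toReal = Real.pi * 4 / 3 :=
    ENNReal.toReal_ofReal (by positivity)
  simp only [Measure.real, EuclideanSpace.volume_ball_fin_three, finrank_euclideanSpace,
    Fintype.card_fin, ENNReal.ofReal_one, one_pow, one_mul, hpi, smul_eq_mul, nsmul_eq_mul]
  push_cast
  ring

lemma norm_sq_coord (y : E3) : ‖y‖ ^ 2 = ∑ i, y i ^ 2 := by
  rw [EuclideanSpace.norm_sq_eq]; simp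

lemma SE_pos {y : E3} (hy : y ∈ SE) : 0 < ‖y‖ := lt_of_lt_of_le one_pos hy.1

lemma SE_meas : MeasurableSet SE := SE_compact.isClosed.measurableSet

lemma I2_eq (i j : Fin 3) :
    ∫ y in SE, (y i * y j) / ‖y‖ ^ 5 = 5 / 3 * Phi (e3 0) * dl i j := by
  have h : ∫ y in SE, (y i * y j) / ‖y‖ ^ 5 =
      ∫ y in SE, ∑ k, (y i * y j * y k * y k) / ‖y‖ ^ 7 := by
    refine setIntegral_congr_fun SE_meas fun y hy => ?_
    have hp := SE_pos hy
    have := norm_sq_coord y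
    simp only [← Finset.sum_div]
    have h2 : ∑ k, (y i * y j * y k * y k) = y i * y j * ‖y‖ ^ 2 := by
      rw [this, Finset.mul_sum]; exact Finset.sum_congr rfl fun _ _ => by ring
    rw [h2]; field_simp
  rw [h, integral_finsetSum]
  · simp only [I4_eq]
    fin_cases i <;> fin_cases j <;> simp [dl, Fin.sum_univ_three] <;> ring
  · intro k _
    exact SE_integrable _ (by fun_prop)

lemma C_eq : Phi (e3 0) = 4 * Real.pi * Real.log 2 / 5 := by
  have h : ∫ y in SE, 1 / ‖y‖ ^ 3 =
      ∫ y in SE, ∑ k, (y k * y k) / ‖y‖ ^ 5 := by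
    refine setIntegral_congr_fun SE_meas fun y hy => ?_
    have hp := SE_pos hy
    have := norm_sq_coord y
    simp only [← Finset.sum_div]
    have h2 : ∑ k, (y k * y k) = ‖y‖ ^ 2 := by
      rw [this]; exact Finset.sum_congr rfl fun _ _ => by ring
    rw [h2]; field_simp
  rw [radial, integral_finsetSum] at h
  · simp only [I2_eq, dl, Fin.sum_univ_three] at h
    norm_num at h
    linarith
  · intro k _
    refine ContinuousOn.integrableOn_compact SE_compact ?_
    refine ContinuousOn.div (by fun_prop) (by fun_prop) ?_
    intro y hy
    have := SE_pos hy
    positivity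

lemma T_eq (i j α β : Fin 3) :
    ∫ y in SE, (y i * y j) / ‖y‖ ^ 5 * (dl α β - y α * y β / ‖y‖ ^ 2) =
     (4 * Real.pi * Real.log 2 / 15) * (4 * dl i j * dl α β - dl i α * dl j β - dl i β * dl j α) := by
  have h : ∫ y in SE, (y i * y j) / ‖y‖ ^ 5 * (dl α β - y α * y β / ‖y‖ ^ 2) =
      ∫ y in SE, (dl α β * ((y i * y j) / ‖y‖ ^ 5) - (y i * y j * y α * y β) / ‖y‖ ^ 7) := by
    refine setIntegral_congr_fun SE_meas fun y hy => ?_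
    have hp := SE_pos hy
    simp only
    field_simp
  rw [h, integral_sub, integral_const_mul, I2_eq, I4_eq, C_eq]
  · ring
  · apply Integrable.const_mul
    refine ContinuousOn.integrableOn_compact SE_compact ?_
    refine ContinuousOn.div (by fun_prop) (by fun_prop) ?_
    intro y hy
    have := SE_pos hy
    positivity
  · exact SE_integrable _ (by fun_prop)

lemma enorm3_eq (x : Fin 3 → ℝ) : enorm3 x = ‖(WithLp.toLp 2 x : E3)‖ := by
  rw [EuclideanSpace.norm_eq]; simp [enorm3]

lemma enorm3_continuous : Continuous enorm3 := by
  unfold enorm3; fun_prop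

def S3 : Set (Fin 3 → ℝ) := {x | 1 ≤ enorm3 x ∧ enorm3 x ≤ 2}

lemma S3_eq : S3 = (WithLp.toLp 2 : (Fin 3 → ℝ) → E3) ⁻¹' SE := by
  ext x; simp [S3, SE, enorm3_eq]

lemma S3_compact : IsCompact S3 := by
  have : S3 = (WithLp.ofLp : E3 → (Fin 3 → ℝ)) '' SE := by
    ext x
    rw [S3_eq]
    constructor
    · intro h; exact ⟨_, h, rfl⟩
    · rintro ⟨y, hy, rfl⟩; exact hy
  rw [this]
  exact SE_compact.image (PiLp.continuous_ofLp 2 _)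

lemma S3_frontier : volume (frontier S3) = 0 := by
  have hsub : frontier S3 ⊆ (WithLp.toLp 2 : (Fin 3 → ℝ) → E3) ⁻¹'
      (Metric.sphere 0 1 ∪ Metric.sphere 0 2) := by
    intro x hx
    have hcl : x ∈ S3 := S3_compact.isClosed.frontier_subset hx
    have hni : x ∉ interior S3 := hx.2
    by_contra hcon
    apply hni
    simp only [Set.mem_preimage, Set.mem_union, mem_sphere_zero_iff_norm, ← enorm3_eq,
      not_or] at hcon
    rw [mem_interior]
    refine ⟨{x | 1 < enorm3 x ∧ enorm3 x < 2}, fun y hy => ⟨hy.1.le, hy.2.le⟩, ?_, ?_⟩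
    · exact (isOpen_lt continuous_const enorm3_continuous).inter
        (isOpen_lt enorm3_continuous continuous_const)
    · exact ⟨lt_of_le_of_ne hcl.1 (Ne.symm hcon.1), lt_of_le_of_ne hcl.2 hcon.2⟩
  refine measure_mono_null hsub ?_
  rw [(PiLp.volume_preserving_toLp (Fin 3)).measure_preimage]
  · exact measure_union_null (Measure.addHaar_sphere _ _ _) (Measure.addHaar_sphere _ _ _)
  · exact (Metric.isClosed_sphere.union Metric.isClosed_sphere).measurableSet.nullMeasurableSet

def GG (i j α β : Fin 3) (x : Fin 3 → ℝ) : ℝ :=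
  x i * x j / (max 1 (enorm3 x)) ^ 5 * (dl α β - x α * x β / (max 1 (enorm3 x)) ^ 2)

lemma GG_continuous (i j α β : Fin 3) : Continuous (GG i j α β) := by
  have hm : Continuous fun x => max 1 (enorm3 x) := continuous_const.max enorm3_continuous
  have hp : ∀ x, 0 < max 1 (enorm3 x) := fun x => lt_of_lt_of_le one_pos (le_max_left _ _)
  unfold GG
  refine Continuous.mul (Continuous.div (by fun_prop) (hm.pow 5) fun x => ?_)
    (continuous_const.sub (Continuous.div (by fun_prop) (hm.pow 2) fun x => ?_))
  · exact (pow_pos (hp x) _).ne'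
  · exact (pow_pos (hp x) _).ne'

lemma GG_integral (i j α β : Fin 3) : ∫ x in S3, GG i j α β x =
     (4 * Real.pi * Real.log 2 / 15) * (4 * dl i j * dl α β - dl i α * dl j β - dl i β * dl j α) := by
  rw [← T_eq, S3_eq]
  have h := (PiLp.volume_preserving_toLp (Fin 3)).setIntegral_preimage_emb
    (MeasurableEquiv.toLp 2 (Fin 3 → ℝ)).measurableEmbedding
    (fun y : E3 => (y i * y j) / ‖y‖ ^ 5 * (dl α β - y α * y β / ‖y‖ ^ 2)) SE
  rw [← h, ← S3_eq]
  refine setIntegral_congr_fun S3_compact.isClosed.measurableSet fun x hx => ?_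
  simp only [GG, max_eq_right hx.1, ← enorm3_eq]

open scoped Classical in
def tm (n : ℕ) (i j α β : Fin 3) (k : Fin 3 → ℤ) : ℝ :=
    if k ≠ 0 ∧ (n : ℝ) ≤ znorm3 k ∧ znorm3 k ≤ 2 * n then
      (((k i : ℝ) * (k j : ℝ)) / znorm3 k ^ 5) *
        ((if α = β then (1 : ℝ) else 0) - (k α : ℝ) * (k β : ℝ) / znorm3 k ^ 2)
    else 0

def emb (n : ℕ) (k : Fin 3 → ℤ) : Fin 3 → ℝ := fun i => (n : ℝ)⁻¹ * (k i : ℝ)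

lemma emb_inj {n : ℕ} (hn : 0 < n) : Function.Injective (emb n) := by
  intro k l h
  ext i
  have := congrFun h i
  have hn' : (n : ℝ) ≠ 0 := by positivity
  simpa [emb, hn'] using this

lemma enorm3_emb (n : ℕ) (k : Fin 3 → ℤ) : enorm3 (emb n k) = (n : ℝ)⁻¹ * znorm3 k := by
  unfold enorm3 emb znorm3
  simp only [mul_pow, ← Finset.mul_sum]
  rw [Real.sqrt_mul (by positivity), Real.sqrt_sq (by positivity)]

lemma emb_mem {n : ℕ} (hn : 0 < n) (k : Fin 3 → ℤ) :
    emb n k ∈ S3 ↔ (k ≠ 0 ∧ (n : ℝ) ≤ znorm3 k ∧ znorm3 k ≤ 2 * n) := by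
  have hn' : (0 : ℝ) < n := by positivity
  have h0 : (n : ℝ) ≤ znorm3 k → k ≠ 0 := by
    rintro h rfl
    simp [znorm3] at h
    omega
  have h1 : (1 ≤ (n : ℝ)⁻¹ * znorm3 k) ↔ (n : ℝ) ≤ znorm3 k := by
    rw [le_inv_mul_iff₀ hn', mul_one]
  have h2 : ((n : ℝ)⁻¹ * znorm3 k ≤ 2) ↔ znorm3 k ≤ 2 * n := by
    rw [inv_mul_le_iff₀ hn', mul_comm]
  simp only [S3, Set.mem_ofPred_eq, enorm3_emb, h1, h2]
  tauto

open scoped Pointwise in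
lemma emb_range {n : ℕ} (hn : 0 < n) : Set.range (emb n) =
    (n : ℝ)⁻¹ • (Submodule.span ℤ (Set.range (Pi.basisFun ℝ (Fin 3))) : Set (Fin 3 → ℝ)) := by
  ext x
  rw [Set.mem_smul_set]
  constructor
  · rintro ⟨k, rfl⟩
    refine ⟨fun i => (k i : ℝ), ?_, ?_⟩
    · rw [SetLike.mem_coe, Module.Basis.mem_span_iff_repr_mem]
      intro i; simp
    · ext i; simp [emb]
  · rintro ⟨y, hy, rfl⟩
    rw [SetLike.mem_coe, Module.Basis.mem_span_iff_repr_mem] at hy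
    choose k hk using hy
    refine ⟨k, ?_⟩
    ext i
    have := hk i
    simp at this
    simp [emb, this]

lemma tm_eq {n : ℕ} (hn : 0 < n) (i j α β : Fin 3) (k : Fin 3 → ℤ) :
    tm n i j α β k = S3.indicator (GG i j α β) (emb n k) / n ^ 3 := by
  have hn' : (0 : ℝ) < n := by positivity
  by_cases h : emb n k ∈ S3
  · have h' := (emb_mem hn k).1 h
    rw [Set.indicator_of_mem h, tm, if_pos h', GG, max_eq_right h.1, enorm3_emb]
    have hz : 0 < znorm3 k := lt_of_lt_of_le hn' h'.2.1
    simp only [emb, dl]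
    field_simp
  · have h' := mt (emb_mem hn k).2 h
    rw [Set.indicator_of_notMem h, tm, if_neg h', zero_div]

open scoped Pointwise in
lemma tm_tsum {n : ℕ} (hn : 0 < n) (i j α β : Fin 3) :
    ∑' k, tm n i j α β k = (∑' x : ↑(S3 ∩ (n : ℝ)⁻¹ •
      (Submodule.span ℤ (Set.range (Pi.basisFun ℝ (Fin 3))) : Set (Fin 3 → ℝ))),
        GG i j α β x) / (n : ℝ) ^ Fintype.card (Fin 3) := by
  rw [← emb_range hn, tsum_subtype, Fintype.card_fin]
  simp only [tm_eq hn]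
  rw [tsum_div_const]
  congr 1
  rw [← (emb_inj hn).tsum_eq]
  · congr 1; ext k
    have hk : emb n k ∈ S3 ∩ Set.range (emb n) ↔ emb n k ∈ S3 :=
      ⟨fun h => h.1, fun h => ⟨h, k, rfl⟩⟩
    by_cases h : emb n k ∈ S3
    · rw [Set.indicator_of_mem h, Set.indicator_of_mem (hk.2 h)]
    · rw [Set.indicator_of_notMem h, Set.indicator_of_notMem (mt hk.1 h)]
  · intro x hx
    have := Set.indicator_apply_ne_zero.1 hx
    exact this.1.2

lemma tm_tendsto (i j α β : Fin 3) :
    Filter.Tendsto (fun n => ∑' k, tm n i j α β k) Filter.atTop (nhds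
     ((4 * Real.pi * Real.log 2 / 15) * (4 * dl i j * dl α β - dl i α * dl j β - dl i β * dl j α))) := by
  rw [← GG_integral]
  refine (tendsto_tsum_div_pow_atTop_integral S3 (GG i j α β) (GG_continuous i j α β)
    S3_compact.isBounded S3_compact.isClosed.measurableSet S3_frontier).congr' ?_
  filter_upwards [Filter.eventually_gt_atTop 0] with n hn
  exact (tm_tsum hn i j α β).symm

lemma tm_summable (n : ℕ) (i j α β : Fin 3) : Summable (tm n i j α β) := by
  have hfin : (Set.univ.pi fun _ : Fin 3 => Set.Icc (-(2 * n : ℤ)) (2 * n)).Finite :=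
    Set.Finite.pi fun _ => Set.finite_Icc _ _
  apply summable_of_hasFiniteSupport
  refine hfin.subset ?_
  intro k hk l _
  have h : k ≠ 0 ∧ (n : ℝ) ≤ znorm3 k ∧ znorm3 k ≤ 2 * n := by
    by_contra h
    exact hk (by rw [tm, if_neg h])
  have h1 : |(k l : ℝ)| ≤ znorm3 k := by
    rw [znorm3, ← Real.sqrt_sq_eq_abs]
    exact Real.sqrt_le_sqrt (Finset.single_le_sum (f := fun i => (k i : ℝ) ^ 2)
      (fun _ _ => sq_nonneg _) (Finset.mem_univ l))
  have h2 := abs_le.1 (h1.trans h.2.2)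
  constructor
  · exact_mod_cast h2.1
  · exact_mod_cast h2.2

lemma Ln_eq (n : ℕ) (b : Fin 3 → ℝ) (α β : Fin 3) :
    Ln n b α β = ∑ i, ∑ j, b i * b j * ∑' k, tm n i j α β k := by
  simp only [← tsum_mul_left]
  have hs : ∀ i j, Summable fun k => b i * b j * tm n i j α β k :=
    fun i j => (tm_summable n i j α β).mul_left _
  have h1 : ∀ i, ∑ j, ∑' k, b i * b j * tm n i j α β k =
      ∑' k, ∑ j, b i * b j * tm n i j α β k := fun i =>
    (Summable.tsum_finsetSum fun j _ => hs i j).symm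
  simp only [h1]
  rw [← Summable.tsum_finsetSum fun i _ => summable_sum fun j _ => hs i j]
  unfold Ln
  congr 1; ext k
  unfold tm
  split_ifs with h
  · simp only [Fin.sum_univ_three]; ring
  · simp only [Fin.sum_univ_three]; ring
  · simp

lemma Lentry_eq (b : Fin 3 → ℝ) (α β : Fin 3) :
    Lentry b α β = ∑ i, ∑ j, b i * b j * ((4 * Real.pi * Real.log 2 / 15) *
      (4 * dl i j * dl α β - dl i α * dl j β - dl i β * dl j α)) := by
  have : enorm3 b ^ 2 = ∑ i, b i ^ 2 := Real.sq_sqrt (Finset.sum_nonneg fun _ _ => sq_nonneg _)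
  unfold Lentry
  rw [this]
  fin_cases α <;> fin_cases β <;> simp [dl, Fin.sum_univ_three] <;> ring

/-- `ℒⁿ(b) → ℒ(b)` as `n → ∞`, uniformly (in all entries) on compact
subsets of `ℝ³`. -/
theorem Ln_tendsto_Lentry_uniformly_on_compacts :
    ∀ K : Set (Fin 3 → ℝ), IsCompact K →
      ∀ ε > (0 : ℝ), ∃ N : ℕ, ∀ n ≥ N, ∀ b ∈ K, ∀ α β : Fin 3,
        |Ln n b α β - Lentry b α β| < ε := by
  intro K hK ε hε
  obtain ⟨M, hM⟩ := hK.isBounded.exists_norm_le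
  set δ : ℝ := ε / (9 * (M ^ 2 + 1)) with hδ
  have hM2 : 0 < M ^ 2 + 1 := by positivity
  have hδp : 0 < δ := by positivity
  have hev : ∀ᶠ n : ℕ in Filter.atTop, ∀ i j α β : Fin 3,
      |∑' k, tm n i j α β k - (4 * Real.pi * Real.log 2 / 15) *
        (4 * dl i j * dl α β - dl i α * dl j β - dl i β * dl j α)| < δ := by
    simp only [Filter.eventually_all]
    intro i j α β
    have := Metric.tendsto_nhds.1 (tm_tendsto i j α β) δ hδp
    simpa only [Real.dist_eq] using this
  obtain ⟨N, hN⟩ := Filter.eventually_atTop.1 hev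
  refine ⟨N, fun n hn b hb α β => ?_⟩
  have hbi : ∀ i, |b i| ≤ M := fun i => (norm_le_pi_norm b i).trans (hM b hb)
  have hM0 : 0 ≤ M := (abs_nonneg _).trans (hbi 0)
  rw [Ln_eq, Lentry_eq]
  simp only [← Finset.sum_sub_distrib, ← mul_sub]
  have hb1 : ∀ i j : Fin 3, |b i * b j * (∑' k, tm n i j α β k - (4 * Real.pi * Real.log 2 / 15) *
        (4 * dl i j * dl α β - dl i α * dl j β - dl i β * dl j α))| ≤ M ^ 2 * δ := by
    intro i j
    rw [abs_mul, abs_mul, sq]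
    have := hN n hn i j α β
    have h1 := hbi i
    have h2 := hbi j
    gcongr
  calc _ ≤ ∑ i : Fin 3, ∑ j : Fin 3, M ^ 2 * δ :=
        (Finset.abs_sum_le_sum_abs _ _).trans (Finset.sum_le_sum fun i _ =>
          (Finset.abs_sum_le_sum_abs _ _).trans (Finset.sum_le_sum fun j _ => hb1 i j))
    _ = 9 * M ^ 2 * δ := by simp; ring
    _ < 9 * (M ^ 2 + 1) * δ := by nlinarith
    _ = ε := by rw [hδ]; field_simp
end
end
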